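/- Fractional Poincaré inequality: For every s ∈ (0,1) there exists a constant C = C(d, s) such that for every n ∈ ℤ and every continuously differentiable u on a neighbourhood of the closure of Q_n, ‖u − (u)_{Q_n}‖_{H̲^s(Q_n)} ≤ C ‖∇u‖_{H̲̊^{−(1−s)}(Q_n)}. -/

import Mathlib

open MeasureTheory

noncomputable section

/-- The triadic cube `Q_n = (-3^n/2, 3^n/2)^d` in `ℝ^d`. -/
def Qc (d : ℕ) (n : ℤ) : Set (Fin d → ℝ) := {x | ∀ i, |x i| < 3 ^ n / 2}

/-- The cube `z + Q_k` of scale `k` centred at `z`. -/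
def cube (d : ℕ) (k : ℤ) (z : Fin d → ℝ) : Set (Fin d → ℝ) := {x | ∀ i, |x i - z i| < 3 ^ k / 2}

/-- The lattice `3^r ℤ^d` viewed inside `ℝ^d`. -/
def latt (d : ℕ) (r : ℤ) : Set (Fin d → ℝ) := {z | ∃ m : Fin d → ℤ, z = fun i => 3 ^ r * (m i : ℝ)}

/-- The lattice points `z ∈ 3^{k-1}ℤ^d` such that `z + Q_k ⊆ Q_n`. -/
def subLatt (d : ℕ) (k n : ℤ) : Set (Fin d → ℝ) :=
  {z | z ∈ latt d (k - 1) ∧ cube d k z ⊆ Qc d n}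

/-- Average of `f` over a (finite) set `S`. -/
def avgSet {α : Type*} (S : Set α) (f : α → ℝ) : ℝ := (S.ncard : ℝ)⁻¹ * ∑ᶠ z ∈ S, f z

/-- The normalized fractional seminorm `[g]_{H̲^s(Q_n)}`, the sum over scales `k ≤ n`
(written `k = n - j`) of `3^{-2sk}` times the average over `z ∈ 3^{k-1}ℤ^d` with
`z + Q_k ⊆ Q_n` of `‖g - (g)_{z+Q_k}‖²_{L̲²(z+Q_k)}`. -/
def fracSemi (d : ℕ) (s : ℝ) (n : ℤ) (g : (Fin d → ℝ) → ℝ) : ℝ :=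
  Real.sqrt (∑' j : ℕ, (3 : ℝ) ^ (-2 * s * ((n : ℝ) - (j : ℝ))) *
    avgSet (subLatt d (n - j) n) (fun z =>
      ⨍ x in cube d (n - j) z, (g x - ⨍ y in cube d (n - j) z, g y) ^ 2))

/-- The normalized norm `‖g‖_{H̲^s(Q_n)} = 3^{-sn}‖g‖_{L̲²(Q_n)} + [g]_{H̲^s(Q_n)}`. -/
def fracNorm (d : ℕ) (s : ℝ) (n : ℤ) (g : (Fin d → ℝ) → ℝ) : ℝ :=
  (3 : ℝ) ^ (-(s * (n : ℝ))) * Real.sqrt (⨍ x in Qc d n, (g x) ^ 2) + fracSemi d s n g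

/-- The quantity `‖F‖_{H̲̊^{-s}(Q_n)}` for a vector field `F`: the square root of the sum over
scales `k ≤ n` of `3^{2sk}` times the average over `z ∈ 3^{k-1}ℤ^d`, `z + Q_k ⊆ Q_n`, of
`|(F)_{z+Q_k}|²`. -/
def ringNeg (d : ℕ) (s : ℝ) (n : ℤ) (F : (Fin d → ℝ) → (Fin d → ℝ)) : ℝ :=
  Real.sqrt (∑' j : ℕ, (3 : ℝ) ^ (2 * s * ((n : ℝ) - (j : ℝ))) *
    avgSet (subLatt d (n - j) n) (fun z => ∑ i, (⨍ x in cube d (n - j) z, F x i) ^ 2))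

/-- The gradient of a scalar function on `ℝ^d`, as a vector field. -/
def grad (d : ℕ) (u : (Fin d → ℝ) → ℝ) (x : Fin d → ℝ) : Fin d → ℝ :=
  fun i => fderiv ℝ u x (Pi.single i 1)

/-! ### Triadic indices -/

/-- Largest absolute value of a coordinate of the index of a cube of generation `J`. -/
def idxRadius (J : ℕ) : ℤ := 3 * ((3 ^ J - 1) / 2)

/-- Indices `m` of the cubes of scale `n - J`, centred at `3 ^ (n - J - 1) * m`, inside `Q_n`. -/
def subIdx (d J : ℕ) : Finset (Fin d → ℤ) :=
  Fintype.piFinset fun _ => Finset.Icc (-idxRadius J) (idxRadius J)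

/-- The offsets `{-1, 0, 1} ^ d` of the triadic children of a cube. -/
def offs (d : ℕ) : Finset (Fin d → ℤ) := Fintype.piFinset fun _ => Finset.Icc (-1) 1

/-- Index of the child of the cube of index `m` with offset `δ`. -/
def child {d : ℕ} (m δ : Fin d → ℤ) : Fin d → ℤ := fun i => 3 * (m i + δ i)

/-- Average of `f` over the children of `m`. -/
def childAvg {d : ℕ} (f : (Fin d → ℤ) → ℝ) (m : Fin d → ℤ) : ℝ :=
  ((3 : ℝ) ^ d)⁻¹ * ∑ δ ∈ offs d, f (child m δ)

/-- Average of `f` over all the indices of generation `J`. -/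
def idxAvg {d : ℕ} (J : ℕ) (f : (Fin d → ℤ) → ℝ) : ℝ :=
  ((subIdx d J).card : ℝ)⁻¹ * ∑ m ∈ subIdx d J, f m

lemma two_mul_idxRadius (J : ℕ) : 2 * idxRadius J = 3 ^ (J + 1) - 3 := by
  have h : Odd ((3 : ℤ) ^ J) := Odd.pow (by decide)
  obtain ⟨t, ht⟩ := h
  unfold idxRadius
  rw [pow_succ]
  omega

lemma mem_subIdx {d J : ℕ} {m : Fin d → ℤ} :
    m ∈ subIdx d J ↔ ∀ i, 2 * |m i| + 3 ≤ 3 ^ (J + 1) := by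
  have h := two_mul_idxRadius J
  simp only [subIdx, Fintype.mem_piFinset, Finset.mem_Icc, ← abs_le]
  refine forall_congr' fun i => ?_
  constructor <;> intro h' <;> linarith

lemma mem_offs {d : ℕ} {δ : Fin d → ℤ} : δ ∈ offs d ↔ ∀ i, -1 ≤ δ i ∧ δ i ≤ 1 := by
  simp [offs, Fintype.mem_piFinset]

lemma card_offs (d : ℕ) : (offs d).card = 3 ^ d := by
  simp [offs, Fintype.card_piFinset]

lemma card_subIdx_le (d J : ℕ) : ((subIdx d J).card : ℝ) ≤ (3 ^ d) ^ (J + 1) := by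
  have h := two_mul_idxRadius J
  have h1 : ((idxRadius J + 1 - -idxRadius J).toNat : ℤ) ≤ 3 ^ (J + 1) := by
    have : (0 : ℤ) < 3 ^ (J + 1) := by positivity
    omega
  have h2 : ((idxRadius J + 1 - -idxRadius J).toNat : ℝ) ≤ 3 ^ (J + 1) := by exact_mod_cast h1
  simp only [subIdx, Fintype.card_piFinset, Int.card_Icc, Finset.prod_const, Finset.card_univ,
    Fintype.card_fin, Nat.cast_pow]
  calc _ ≤ ((3 : ℝ) ^ (J + 1)) ^ d := by gcongr
    _ = _ := by rw [← pow_mul, ← pow_mul, mul_comm]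

lemma le_card_subIdx (d J : ℕ) : ((3 : ℝ) ^ d) ^ J ≤ (subIdx d J).card := by
  have h := two_mul_idxRadius J
  have h1 : (3 : ℤ) ^ J ≤ ((idxRadius J + 1 - -idxRadius J).toNat : ℤ) := by
    have : (0 : ℤ) < 3 ^ J := by positivity
    rw [pow_succ] at h
    omega
  have h2 : (3 : ℝ) ^ J ≤ ((idxRadius J + 1 - -idxRadius J).toNat : ℝ) := by exact_mod_cast h1
  simp only [subIdx, Fintype.card_piFinset, Int.card_Icc, Finset.prod_const, Finset.card_univ,
    Fintype.card_fin, Nat.cast_pow]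
  calc _ = ((3 : ℝ) ^ J) ^ d := by rw [← pow_mul, ← pow_mul, mul_comm]
    _ ≤ _ := by gcongr

lemma card_subIdx_pos (d J : ℕ) : (0 : ℝ) < (subIdx d J).card :=
  lt_of_lt_of_le (by positivity) (le_card_subIdx d J)

lemma child_mem {d J : ℕ} {m δ : Fin d → ℤ} (hm : m ∈ subIdx d J) (hδ : δ ∈ offs d) :
    child m δ ∈ subIdx d (J + 1) := by
  rw [mem_subIdx] at hm ⊢
  rw [mem_offs] at hδ
  intro i
  have h1 := hm i
  have h2 := hδ i
  simp only [child, abs_mul]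
  have h3 : |m i + δ i| ≤ |m i| + 1 := (abs_add_le _ _).trans (by gcongr; exact abs_le.2 h2)
  rw [pow_succ 3 (J + 1)]
  norm_num
  linarith

lemma idxAvg_nonneg {d J : ℕ} {f : (Fin d → ℤ) → ℝ} (hf : ∀ m ∈ subIdx d J, 0 ≤ f m) :
    0 ≤ idxAvg J f :=
  mul_nonneg (by positivity) (Finset.sum_nonneg hf)

lemma idxAvg_mono {d J : ℕ} {f g : (Fin d → ℤ) → ℝ} (hf : ∀ m ∈ subIdx d J, f m ≤ g m) :
    idxAvg J f ≤ idxAvg J g :=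
  mul_le_mul_of_nonneg_left (Finset.sum_le_sum hf) (by positivity)

lemma idxAvg_le {d J : ℕ} {f : (Fin d → ℤ) → ℝ} {M : ℝ} (hf : ∀ m ∈ subIdx d J, f m ≤ M) :
    idxAvg J f ≤ M := by
  refine (idxAvg_mono hf).trans (le_of_eq ?_)
  have := card_subIdx_pos d J
  simp only [idxAvg, Finset.sum_const, nsmul_eq_mul]
  field_simp

lemma idxAvg_const_mul {d J : ℕ} (f : (Fin d → ℤ) → ℝ) (c : ℝ) :
    idxAvg J (fun m => c * f m) = c * idxAvg J f := by
  simp only [idxAvg, ← Finset.mul_sum]; ring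

lemma card_mul_idxAvg {d J : ℕ} (f : (Fin d → ℤ) → ℝ) :
    (subIdx d J).card * idxAvg J f = ∑ m ∈ subIdx d J, f m := by
  have := card_subIdx_pos d J
  simp only [idxAvg]
  field_simp

lemma childAvg_add {d : ℕ} (f g : (Fin d → ℤ) → ℝ) (m : Fin d → ℤ) :
    childAvg (fun m => f m + g m) m = childAvg f m + childAvg g m := by
  simp only [childAvg, Finset.sum_add_distrib]; ring

lemma childAvg_const_mul {d : ℕ} (f : (Fin d → ℤ) → ℝ) (c : ℝ) (m : Fin d → ℤ) :
    childAvg (fun m => c * f m) m = c * childAvg f m := by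
  simp only [childAvg, ← Finset.mul_sum]; ring

/-- A one-generation inequality iterates along families of disjoint cubes. -/
lemma sum_le_of_childAvg_le {d : ℕ} {ρ : ℝ} (hρ : 0 ≤ ρ) {X Y : ℕ → (Fin d → ℤ) → ℝ}
    (hX : ∀ J, ∀ m ∈ subIdx d J, 0 ≤ X J m) (hY : ∀ J, ∀ m ∈ subIdx d J, 0 ≤ Y J m)
    (h : ∀ J, ∀ m ∈ subIdx d J, X J m ≤ ρ * childAvg (X (J + 1)) m + childAvg (Y (J + 1)) m)
    (j J : ℕ) (S : Finset (Fin d → ℤ)) (hS : S ⊆ subIdx d J)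
    (hS3 : ∀ m ∈ S, ∀ m' ∈ S, ∀ i, (3 : ℤ) ∣ m i - m' i) :
    ∑ m ∈ S, X J m ≤ (ρ * ((3 : ℝ) ^ d)⁻¹) ^ j * ∑ m ∈ subIdx d (J + j), X (J + j) m +
      ∑ l ∈ Finset.range j, ρ ^ l * (((3 : ℝ) ^ d)⁻¹) ^ (l + 1) *
        ∑ m ∈ subIdx d (J + l + 1), Y (J + l + 1) m := by
  induction j generalizing J S with
  | zero =>
    simpa using Finset.sum_le_sum_of_subset_of_nonneg hS fun m hm _ => hX J m hm
  | succ j ih =>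
    classical
    set S' : Finset (Fin d → ℤ) := (S ×ˢ offs d).image fun p => child p.1 p.2 with hS'
    have hinj : Set.InjOn (fun p : (Fin d → ℤ) × (Fin d → ℤ) => child p.1 p.2)
        (S ×ˢ offs d : Finset _) := by
      rintro ⟨m, δ⟩ hp ⟨m', δ'⟩ hp' he
      simp only [Finset.coe_product, Set.mem_prod, Finset.mem_coe] at hp hp'
      have key : ∀ i, m i = m' i ∧ δ i = δ' i := by
        intro i
        have h1 := hS3 m hp.1 m' hp'.1 i
        have h2 := mem_offs.1 hp.2 i
        have h3 := mem_offs.1 hp'.2 i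
        have h4 : 3 * (m i + δ i) = 3 * (m' i + δ' i) := congrFun he i
        omega
      exact Prod.ext (funext fun i => (key i).1) (funext fun i => (key i).2)
    have hsum : ∀ f : (Fin d → ℤ) → ℝ,
        ∑ m ∈ S, childAvg f m = ((3 : ℝ) ^ d)⁻¹ * ∑ m ∈ S', f m := by
      intro f
      rw [hS', Finset.sum_image hinj, Finset.sum_product, Finset.mul_sum]
      rfl
    have hsub : S' ⊆ subIdx d (J + 1) := by
      intro m hm
      obtain ⟨p, hp, rfl⟩ := Finset.mem_image.1 hm
      rw [Finset.mem_product] at hp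
      exact child_mem (hS hp.1) hp.2
    have hS3' : ∀ m ∈ S', ∀ m' ∈ S', ∀ i, (3 : ℤ) ∣ m i - m' i := by
      intro m hm m' hm' i
      obtain ⟨p, hp, rfl⟩ := Finset.mem_image.1 hm
      obtain ⟨p', hp', rfl⟩ := Finset.mem_image.1 hm'
      simp only [child]
      omega
    have h1 : ∑ m ∈ S, X J m ≤ ρ * (((3 : ℝ) ^ d)⁻¹ * ∑ m ∈ S', X (J + 1) m) +
        ((3 : ℝ) ^ d)⁻¹ * ∑ m ∈ S', Y (J + 1) m := by
      rw [← hsum, ← hsum, Finset.mul_sum, ← Finset.sum_add_distrib]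
      exact Finset.sum_le_sum fun m hm => h J m (hS hm)
    have h2 := ih (J + 1) S' hsub hS3'
    have h3 : ∑ m ∈ S', Y (J + 1) m ≤ ∑ m ∈ subIdx d (J + 1), Y (J + 1) m :=
      Finset.sum_le_sum_of_subset_of_nonneg hsub fun m hm _ => hY _ m hm
    have hD : (0 : ℝ) ≤ ((3 : ℝ) ^ d)⁻¹ := by positivity
    have h4 := mul_le_mul_of_nonneg_left h2 (mul_nonneg hρ hD)
    have h5 := mul_le_mul_of_nonneg_left h3 hD
    rw [Finset.sum_range_succ']
    have e : ∀ l, J + (l + 1) + 1 = J + 1 + l + 1 := fun l => by ring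
    have e' : J + (j + 1) = J + 1 + j := by ring
    simp only [e, e', add_zero]
    have h6 : ∑ l ∈ Finset.range j, ρ ^ (l + 1) * (((3 : ℝ) ^ d)⁻¹) ^ (l + 1 + 1) *
          ∑ m ∈ subIdx d (J + 1 + l + 1), Y (J + 1 + l + 1) m =
        ρ * ((3 : ℝ) ^ d)⁻¹ * ∑ l ∈ Finset.range j, ρ ^ l * (((3 : ℝ) ^ d)⁻¹) ^ (l + 1) *
          ∑ m ∈ subIdx d (J + 1 + l + 1), Y (J + 1 + l + 1) m := by
      rw [Finset.mul_sum]
      exact Finset.sum_congr rfl fun l _ => by ring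
    rw [h6, pow_succ]
    simp only [pow_zero, zero_add, pow_one, one_mul]
    linarith

lemma idxAvg_le_of_childAvg_le {d : ℕ} {ρ : ℝ} (hρ : 0 ≤ ρ) {X Y : ℕ → (Fin d → ℤ) → ℝ}
    (hX : ∀ J, ∀ m ∈ subIdx d J, 0 ≤ X J m) (hY : ∀ J, ∀ m ∈ subIdx d J, 0 ≤ Y J m)
    (h : ∀ J, ∀ m ∈ subIdx d J, X J m ≤ ρ * childAvg (X (J + 1)) m + childAvg (Y (J + 1)) m)
    (J j : ℕ) :
    idxAvg J (X J) ≤ 9 ^ d * (ρ ^ j * idxAvg (J + j) (X (J + j)) +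
      ∑ l ∈ Finset.range j, ρ ^ l * idxAvg (J + l + 1) (Y (J + l + 1))) := by
  classical
  set D : ℝ := 3 ^ d with hD
  have hDpos : 0 < D := by positivity
  set R := (ρ * D⁻¹) ^ j * ∑ m ∈ subIdx d (J + j), X (J + j) m +
      ∑ l ∈ Finset.range j, ρ ^ l * (D⁻¹) ^ (l + 1) *
        ∑ m ∈ subIdx d (J + l + 1), Y (J + l + 1) m with hR
  have h1 : ∑ m ∈ subIdx d J, X J m ≤ D * R := by
    rw [← Finset.sum_fiberwise (subIdx d J) (fun m i => ((m i : ℤ) : ZMod 3)) (X J)]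
    calc _ ≤ ∑ _r : Fin d → ZMod 3, R := by
          refine Finset.sum_le_sum fun r _ => ?_
          refine sum_le_of_childAvg_le hρ hX hY h j J _ (Finset.filter_subset _ _) ?_
          intro m hm m' hm' i
          have e1 := congrFun (Finset.mem_filter.1 hm).2 i
          have e2 := congrFun (Finset.mem_filter.1 hm').2 i
          have e3 : ((m i - m' i : ℤ) : ZMod 3) = 0 := by
            push_cast
            rw [sub_eq_zero]
            exact e1.trans e2.symm
          exact (ZMod.intCast_zmod_eq_zero_iff_dvd _ 3).1 e3
      _ = D * R := by simp [hD, ZMod.card]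
  have hN := card_subIdx_pos d J
  have hcmp : ∀ l, (D⁻¹) ^ l * ((subIdx d (J + l)).card : ℝ) ≤ D * (subIdx d J).card := by
    intro l
    have a1 := card_subIdx_le d (J + l)
    have a2 := le_card_subIdx d J
    rw [← hD] at a1 a2
    calc _ ≤ (D⁻¹) ^ l * D ^ (J + l + 1) := by gcongr
      _ = D * D ^ J := by
        rw [inv_pow]; field_simp; ring
      _ ≤ _ := by gcongr
  have h2 : R ≤ D * (subIdx d J).card * (ρ ^ j * idxAvg (J + j) (X (J + j)) +
      ∑ l ∈ Finset.range j, ρ ^ l * idxAvg (J + l + 1) (Y (J + l + 1))) := by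
    rw [hR, mul_add, Finset.mul_sum (Finset.range j)]
    refine add_le_add ?_ (Finset.sum_le_sum fun l _ => ?_)
    · rw [← card_mul_idxAvg, mul_pow]
      have := hcmp j
      have h0 : 0 ≤ ρ ^ j * idxAvg (J + j) (X (J + j)) :=
        mul_nonneg (by positivity) (idxAvg_nonneg (hX _))
      calc _ = ((D⁻¹) ^ j * ((subIdx d (J + j)).card : ℝ)) *
            (ρ ^ j * idxAvg (J + j) (X (J + j))) := by ring
        _ ≤ _ := by gcongr
    · rw [← card_mul_idxAvg]
      have := hcmp (l + 1)
      have h0 : 0 ≤ ρ ^ l * idxAvg (J + l + 1) (Y (J + l + 1)) :=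
        mul_nonneg (by positivity) (idxAvg_nonneg (hY _))
      calc _ = ((D⁻¹) ^ (l + 1) * ((subIdx d (J + (l + 1))).card : ℝ)) *
            (ρ ^ l * idxAvg (J + l + 1) (Y (J + l + 1))) := by rw [← add_assoc]; ring
        _ ≤ _ := by gcongr
  have h3 := h1.trans (mul_le_mul_of_nonneg_left h2 hDpos.le)
  have h9 : (9 : ℝ) ^ d = D * D := by rw [hD, ← mul_pow]; norm_num
  rw [idxAvg, h9, inv_mul_le_iff₀ hN]
  linarith

/-- A discrete convolution estimate with an error vanishing in the limit. -/
lemma sum_le_of_geometric_convolution {a b : ℕ → ℝ} (hb : ∀ J, 0 ≤ b J)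
    (hbs : Summable b) {θ C : ℝ} (hθ : 0 ≤ θ) (hθ1 : θ < 1) (hC : 0 ≤ C) {r : ℕ → ℕ → ℝ}
    (hr : ∀ J, Filter.Tendsto (r J) Filter.atTop (nhds 0))
    (h : ∀ J j, a J ≤ r J j + C * ∑ l ∈ Finset.range j, θ ^ l * b (J + l + 1)) (N : ℕ) :
    ∑ J ∈ Finset.range N, a J ≤ C * (1 - θ)⁻¹ * ∑' J, b J := by
  have h1 : ∀ j, ∑ J ∈ Finset.range N, a J ≤
      ∑ J ∈ Finset.range N, r J j + C * (1 - θ)⁻¹ * ∑' J, b J := by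
    intro j
    have h2 : ∀ l, ∑ J ∈ Finset.range N, b (J + l + 1) ≤ ∑' J, b J := by
      intro l
      have e : ∑ J ∈ Finset.range N, b (J + l + 1) =
          ∑ J ∈ (Finset.range N).map (addRightEmbedding (l + 1)), b J := by
        simp [Finset.sum_map, add_assoc]
      rw [e]
      exact hbs.sum_le_tsum _ fun i _ => hb i
    have h3 : ∑ l ∈ Finset.range j, θ ^ l ≤ (1 - θ)⁻¹ := by
      rw [← tsum_geometric_of_lt_one hθ hθ1]
      exact (summable_geometric_of_lt_one hθ hθ1).sum_le_tsum _ fun i _ => by positivity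
    have hB : 0 ≤ ∑' J, b J := tsum_nonneg hb
    calc _ ≤ ∑ J ∈ Finset.range N,
          (r J j + C * ∑ l ∈ Finset.range j, θ ^ l * b (J + l + 1)) :=
          Finset.sum_le_sum fun J _ => h J j
      _ = ∑ J ∈ Finset.range N, r J j +
          C * ∑ l ∈ Finset.range j, θ ^ l * ∑ J ∈ Finset.range N, b (J + l + 1) := by
          rw [Finset.sum_add_distrib, ← Finset.mul_sum, Finset.sum_comm]
          simp only [Finset.mul_sum]
      _ ≤ ∑ J ∈ Finset.range N, r J j + C * ∑ l ∈ Finset.range j, θ ^ l * ∑' J, b J := by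
          gcongr with l _
          exact h2 l
      _ ≤ _ := by
          rw [← Finset.sum_mul, ← mul_assoc]
          gcongr
  have h4 : Filter.Tendsto (fun j => ∑ J ∈ Finset.range N, r J j + C * (1 - θ)⁻¹ * ∑' J, b J)
      Filter.atTop (nhds (∑ J ∈ Finset.range N, 0 + C * (1 - θ)⁻¹ * ∑' J, b J)) :=
    (tendsto_finsetSum _ fun J _ => hr J).add_const _
  simp only [Finset.sum_const_zero, zero_add] at h4
  exact ge_of_tendsto' h4 h1

set_option maxHeartbeats 400000 in
/-- The summed form of the one-generation inequalities for the variances `V`, the first moments `Λ`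
and the averages `q` of the gradient. -/
lemma sum_idxAvg_le (d : ℕ) {s : ℝ} (hs : 0 < s) (hs1 : s < 1) {C₀ : ℝ} (hC₀ : 0 ≤ C₀) :
    ∃ C : ℝ, 0 < C ∧ ∀ (n : ℤ) (V Λ q : ℕ → (Fin d → ℤ) → ℝ) (M : ℝ),
      (∀ J, ∀ m ∈ subIdx d J, 0 ≤ V J m) → (∀ J, ∀ m ∈ subIdx d J, 0 ≤ Λ J m) →
      (∀ J, ∀ m ∈ subIdx d J, 0 ≤ q J m) →
      (∀ J, ∀ m ∈ subIdx d J, V J m ≤ M * ((3 : ℝ) ^ (n - J : ℤ)) ^ 2) →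
      (∀ J, ∀ m ∈ subIdx d J, Λ J m ≤ M) → (∀ J, ∀ m ∈ subIdx d J, q J m ≤ M) →
      (∀ J, ∀ m ∈ subIdx d J, V J m ≤ childAvg (V (J + 1)) m +
        C₀ * ((3 : ℝ) ^ (n - (J + 1 : ℕ) : ℤ)) ^ 2 *
          childAvg (fun m => q (J + 1) m + Λ (J + 1) m) m) →
      (∀ η : ℝ, 0 < η → ∀ J, ∀ m ∈ subIdx d J, Λ J m ≤
        (1 + η) / 9 * childAvg (Λ (J + 1)) m + (1 + η⁻¹) / 9 * childAvg (q (J + 1)) m) →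
      ∀ N : ℕ, ∑ j ∈ Finset.range N, (3 : ℝ) ^ (-2 * s * ((n : ℝ) - (j : ℝ))) * idxAvg j (V j) ≤
        C * ∑' j : ℕ, (3 : ℝ) ^ (2 * (1 - s) * ((n : ℝ) - (j : ℝ))) * idxAvg j (q j) := by
  set ρ : ℝ := 3 ^ s with hρ
  have hρ1 : 1 < ρ := Real.one_lt_rpow (by norm_num) hs
  have hρ3 : ρ < 3 := by
    calc ρ < 3 ^ (1 : ℝ) := Real.rpow_lt_rpow_of_exponent_lt (by norm_num) hs1
      _ = 3 := Real.rpow_one 3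
  set η : ℝ := (ρ - 1) / 2 with hη
  have hη0 : 0 < η := by rw [hη]; linarith
  set K : ℝ := C₀ / η with hK
  have hK0 : 0 ≤ K := by positivity
  have hKη : C₀ = K * η := by rw [hK]; field_simp
  set C₁ : ℝ := C₀ + K * (1 + η⁻¹) with hC₁
  have hC₁0 : 0 ≤ C₁ := by positivity
  have hθ1 : ρ⁻¹ < 1 := inv_lt_one_of_one_lt₀ hρ1
  refine ⟨9 ^ d * C₁ * (1 - ρ⁻¹)⁻¹ + 1, ?_, ?_⟩
  · have : 0 < 1 - ρ⁻¹ := by linarith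
    positivity
  intro n V Λ q M hV hΛ hq hVM hΛM hqM H1 H2 N
  set h : ℕ → ℝ := fun J => (3 : ℝ) ^ (n - J : ℤ) with hh
  have hpos : ∀ J, 0 < h J := fun J => by simp only [hh]; positivity
  have hsucc : ∀ J, h J = 3 * h (J + 1) := by
    intro J
    simp only [hh]
    rw [← zpow_one_add₀ (by norm_num)]
    congr 1
    push_cast
    ring
  have hadd : ∀ J j, h J = 3 ^ j * h (J + j) := by
    intro J j
    induction j with
    | zero => simp
    | succ j ih => rw [ih, hsucc, pow_succ]; ring_nf
  set w : ℕ → ℝ := fun J => (3 : ℝ) ^ (-2 * s * ((n : ℝ) - (J : ℝ))) with hw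
  have hwpos : ∀ J, 0 < w J := fun J => by simp only [hw]; positivity
  have hwsucc : ∀ J, w (J + 1) = ρ ^ 2 * w J := by
    intro J
    simp only [hw, hρ]
    rw [← Real.rpow_mul_natCast (by norm_num), ← Real.rpow_add (by norm_num)]
    congr 1
    push_cast
    ring
  have hwadd : ∀ J j, w (J + j) = (ρ ^ j) ^ 2 * w J := by
    intro J j
    induction j with
    | zero => simp
    | succ j ih => rw [← add_assoc, hwsucc, ih, pow_succ]; ring
  have hwh : ∀ J : ℕ, (3 : ℝ) ^ (2 * (1 - s) * ((n : ℝ) - (J : ℝ))) = w J * h J ^ 2 := by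
    intro J
    simp only [hw, hh]
    rw [← Real.rpow_intCast, ← Real.rpow_mul_natCast (by norm_num),
      ← Real.rpow_add (by norm_num)]
    congr 1
    push_cast
    ring
  simp only [hwh]
  set X : ℕ → (Fin d → ℤ) → ℝ := fun J m => V J m + K * h J ^ 2 * Λ J m with hX
  have hX0 : ∀ J, ∀ m ∈ subIdx d J, 0 ≤ X J m := fun J m hm =>
    add_nonneg (hV J m hm) (mul_nonneg (by positivity) (hΛ J m hm))
  set Y : ℕ → (Fin d → ℤ) → ℝ := fun J m => C₁ * h J ^ 2 * q J m with hY
  have hY0 : ∀ J, ∀ m ∈ subIdx d J, 0 ≤ Y J m := fun J m hm =>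
    mul_nonneg (by positivity) (hq J m hm)
  have hXY : ∀ J, ∀ m ∈ subIdx d J,
      X J m ≤ ρ * childAvg (X (J + 1)) m + childAvg (Y (J + 1)) m := by
    intro J m hm
    have a1 := H1 J m hm
    have a2 := H2 η hη0 J m hm
    have a3 : 0 ≤ childAvg (V (J + 1)) m :=
      mul_nonneg (by positivity) (Finset.sum_nonneg fun δ hδ => hV _ _ (child_mem hm hδ))
    simp only [hX, hY, childAvg_add, childAvg_const_mul] at a1 ⊢
    have a4 : K * h J ^ 2 * Λ J m ≤ K * h J ^ 2 * ((1 + η) / 9 * childAvg (Λ (J + 1)) m +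
        (1 + η⁻¹) / 9 * childAvg (q (J + 1)) m) := by gcongr
    have a5 : K * h J ^ 2 * ((1 + η) / 9 * childAvg (Λ (J + 1)) m +
        (1 + η⁻¹) / 9 * childAvg (q (J + 1)) m) =
        K * h (J + 1) ^ 2 * ((1 + η) * childAvg (Λ (J + 1)) m +
        (1 + η⁻¹) * childAvg (q (J + 1)) m) := by rw [hsucc J]; ring
    have a6 : childAvg (V (J + 1)) m ≤ ρ * childAvg (V (J + 1)) m :=
      le_mul_of_one_le_left a3 hρ1.le
    have a7 : ρ = 1 + 2 * η := by rw [hη]; ring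
    have a8 : C₀ * h (J + 1) ^ 2 *
        (childAvg (q (J + 1)) m + childAvg (Λ (J + 1)) m) +
        K * h (J + 1) ^ 2 * ((1 + η) * childAvg (Λ (J + 1)) m +
        (1 + η⁻¹) * childAvg (q (J + 1)) m) =
        ρ * (K * h (J + 1) ^ 2 * childAvg (Λ (J + 1)) m) +
        C₁ * h (J + 1) ^ 2 * childAvg (q (J + 1)) m := by
      rw [hC₁, a7, hKη]; ring
    change V J m ≤ childAvg (V (J + 1)) m + C₀ * h (J + 1) ^ 2 *
        (childAvg (q (J + 1)) m + childAvg (Λ (J + 1)) m) at a1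
    linarith
  have hM : 0 ≤ M := by
    have h0 : (0 : Fin d → ℤ) ∈ subIdx d 0 := by rw [mem_subIdx]; simp
    exact (hq 0 0 h0).trans (hqM 0 0 h0)
  have hmain := idxAvg_le_of_childAvg_le (by positivity) hX0 hY0 hXY
  set b : ℕ → ℝ := fun J => w J * h J ^ 2 * idxAvg J (q J) with hb
  have hb0 : ∀ J, 0 ≤ b J := fun J =>
    mul_nonneg (mul_nonneg (hwpos J).le (sq_nonneg _)) (idxAvg_nonneg (hq J))
  have hh0 : ∀ J, h J = h 0 * (3⁻¹) ^ J := by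
    intro J
    have := hadd 0 J
    rw [zero_add] at this
    rw [this, inv_pow]
    field_simp
  have hbs : Summable b := by
    have hg : Summable fun J : ℕ => (w 0 * h 0 ^ 2 * M) * ((ρ / 3) ^ 2) ^ J :=
      (summable_geometric_of_lt_one (by positivity)
        (by rw [sq_lt_one_iff₀ (by positivity)]; linarith)).mul_left _
    refine Summable.of_nonneg_of_le hb0 (fun J => ?_) hg
    have e1 : w J = (ρ ^ J) ^ 2 * w 0 := by simpa using hwadd 0 J
    calc b J ≤ w J * h J ^ 2 * M := by
          have := idxAvg_le (hqM J)
          have := (hwpos J).le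
          simp only [hb]
          gcongr
      _ = _ := by
          rw [e1, hh0 J, pow_right_comm (ρ / 3), div_eq_mul_inv, mul_pow]
          ring
  have hfin := sum_le_of_geometric_convolution
    (a := fun J => w J * idxAvg J (V J)) (b := b) (θ := ρ⁻¹) (C := 9 ^ d * C₁)
    (r := fun J j => w J * 9 ^ d * ((1 + K) * M) * h J ^ 2 * (ρ / 9) ^ j)
    hb0 hbs (by positivity) hθ1 (by positivity) ?_ ?_ N
  · refine hfin.trans ?_
    have : 0 ≤ ∑' J, b J := tsum_nonneg hb0
    linarith
  · intro J
    have := (tendsto_pow_atTop_nhds_zero_of_lt_one (r := ρ / 9) (by positivity)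
      (by linarith)).const_mul (w J * 9 ^ d * ((1 + K) * M) * h J ^ 2)
    simpa using this
  · intro J j
    have b1 : idxAvg J (V J) ≤ idxAvg J (X J) := idxAvg_mono fun m hm =>
      le_add_of_nonneg_right (mul_nonneg (by positivity) (hΛ J m hm))
    have b2 : idxAvg (J + j) (X (J + j)) ≤ (1 + K) * M * h (J + j) ^ 2 := by
      refine idxAvg_le fun m hm => ?_
      have c1 := hVM (J + j) m hm
      have c2 : K * h (J + j) ^ 2 * Λ (J + j) m ≤ K * h (J + j) ^ 2 * M := by
        have := hΛM (J + j) m hm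
        gcongr
      change V (J + j) m ≤ M * h (J + j) ^ 2 at c1
      simp only [hX]
      linarith
    have b3 := b1.trans (hmain J j)
    have b4 : w J * idxAvg J (V J) ≤ w J * (9 ^ d * (ρ ^ j * ((1 + K) * M * h (J + j) ^ 2) +
        ∑ l ∈ Finset.range j, ρ ^ l * idxAvg (J + l + 1) (Y (J + l + 1)))) := by
      refine mul_le_mul_of_nonneg_left (b3.trans ?_) (hwpos J).le
      gcongr
    refine b4.trans ?_
    have b5 : w J * (9 ^ d * (ρ ^ j * ((1 + K) * M * h (J + j) ^ 2))) =
        w J * 9 ^ d * ((1 + K) * M) * h J ^ 2 * (ρ / 9) ^ j := by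
      have e9 : (9 : ℝ) ^ j = (3 ^ j) ^ 2 := by rw [pow_right_comm]; norm_num
      rw [hadd J j, div_pow, e9]
      field_simp
    have b6 : w J * (9 ^ d * ∑ l ∈ Finset.range j,
        ρ ^ l * idxAvg (J + l + 1) (Y (J + l + 1))) ≤
        9 ^ d * C₁ * ∑ l ∈ Finset.range j, ρ⁻¹ ^ l * b (J + l + 1) := by
      simp only [Finset.mul_sum]
      refine Finset.sum_le_sum fun l _ => ?_
      have c1 := hwadd J (l + 1)
      rw [← add_assoc] at c1
      have c2 : idxAvg (J + l + 1) (Y (J + l + 1)) =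
        C₁ * h (J + l + 1) ^ 2 * idxAvg (J + l + 1) (q (J + l + 1)) := idxAvg_const_mul _ _
      have c3 : 0 ≤ 9 ^ d * C₁ * (ρ ^ l * w J *
          (h (J + l + 1) ^ 2 * idxAvg (J + l + 1) (q (J + l + 1)))) :=
        mul_nonneg (mul_nonneg (by positivity) hC₁0)
          (mul_nonneg (mul_nonneg (by positivity) (hwpos J).le)
            (mul_nonneg (sq_nonneg _) (idxAvg_nonneg (hq (J + l + 1)))))
      have c4 : ρ⁻¹ ^ l * (ρ ^ (l + 1)) ^ 2 = ρ ^ 2 * ρ ^ l := by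
        rw [inv_pow]; field_simp; ring
      have c5 : 1 ≤ ρ ^ 2 := one_le_pow₀ hρ1.le
      calc _ = 9 ^ d * C₁ * (ρ ^ l * w J *
          (h (J + l + 1) ^ 2 * idxAvg (J + l + 1) (q (J + l + 1)))) := by rw [c2]; ring
        _ ≤ ρ ^ 2 * (9 ^ d * C₁ * (ρ ^ l * w J *
          (h (J + l + 1) ^ 2 * idxAvg (J + l + 1) (q (J + l + 1))))) :=
          le_mul_of_one_le_left c3 c5
        _ = 9 ^ d * C₁ * ((ρ ^ 2 * ρ ^ l) * w J *
          (h (J + l + 1) ^ 2 * idxAvg (J + l + 1) (q (J + l + 1)))) := by ring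
        _ = _ := by rw [← c4]; simp only [hb]; rw [c1]; ring
    rw [mul_add, mul_add, b5]
    linarith

/-! ### Averages over triadic cubes -/

/-- The centre `3 ^ (k - 1) * m` of the cube of scale `k` and index `m`. -/
def center {d : ℕ} (k : ℤ) (m : Fin d → ℤ) : Fin d → ℝ := fun i => 3 ^ (k - 1) * (m i : ℝ)

/-- The closed cube of scale `k` centred at `z`. -/
def closedCube (d : ℕ) (k : ℤ) (z : Fin d → ℝ) : Set (Fin d → ℝ) :=
  Set.Icc (fun i => z i - 3 ^ k / 2) (fun i => z i + 3 ^ k / 2)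

lemma cube_eq_pi (d : ℕ) (k : ℤ) (z : Fin d → ℝ) :
    cube d k z = Set.univ.pi fun i => Set.Ioo (z i - 3 ^ k / 2) (z i + 3 ^ k / 2) := by
  ext x
  simp only [cube, Set.mem_ofPred_eq, Set.mem_univ_pi, Set.mem_Ioo, abs_lt]
  refine forall_congr' fun i => ?_
  constructor <;> rintro ⟨h1, h2⟩ <;> constructor <;> linarith

lemma Qc_eq_cube (d : ℕ) (n : ℤ) : Qc d n = cube d n 0 := by
  simp [Qc, cube]

lemma cube_ae_eq_closedCube (d : ℕ) (k : ℤ) (z : Fin d → ℝ) :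
    cube d k z =ᵐ[volume] closedCube d k z := by
  rw [cube_eq_pi]
  exact Measure.univ_pi_Ioo_ae_eq_Icc

lemma cube_ae_eq_pi_Ioc (d : ℕ) (k : ℤ) (z : Fin d → ℝ) :
    cube d k z =ᵐ[volume]
      (Set.univ.pi fun i => Set.Ioc (z i - 3 ^ k / 2) (z i + 3 ^ k / 2) : Set (Fin d → ℝ)) :=
  (cube_ae_eq_closedCube d k z).trans Measure.univ_pi_Ioc_ae_eq_Icc.symm

lemma cube_subset_closedCube (d : ℕ) (k : ℤ) (z : Fin d → ℝ) :
    cube d k z ⊆ closedCube d k z := by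
  rw [cube_eq_pi]
  intro x hx
  exact ⟨fun i => (hx i trivial).1.le, fun i => (hx i trivial).2.le⟩

lemma closedCube_eq_closure (d : ℕ) (k : ℤ) (z : Fin d → ℝ) :
    closedCube d k z = closure (cube d k z) := by
  have h : (0 : ℝ) < 3 ^ k := by positivity
  rw [cube_eq_pi, closure_pi_set, closedCube, ← Set.pi_univ_Icc]
  congr 1
  funext i
  rw [closure_Ioo]
  intro h'
  linarith

lemma measurableSet_cube (d : ℕ) (k : ℤ) (z : Fin d → ℝ) : MeasurableSet (cube d k z) := by
  rw [cube_eq_pi]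
  exact MeasurableSet.univ_pi fun _ => measurableSet_Ioo

lemma volume_cube (d : ℕ) (k : ℤ) (z : Fin d → ℝ) :
    volume (cube d k z) = ENNReal.ofReal ((3 : ℝ) ^ k) ^ d := by
  rw [cube_eq_pi, Real.volume_pi_Ioo]
  simp

lemma volume_real_cube (d : ℕ) (k : ℤ) (z : Fin d → ℝ) :
    volume.real (cube d k z) = ((3 : ℝ) ^ k) ^ d := by
  rw [Measure.real, volume_cube, ENNReal.toReal_pow, ENNReal.toReal_ofReal (by positivity)]

/-- Normalized Lebesgue measure on a cube. -/
def cubeMeasure (d : ℕ) (k : ℤ) (z : Fin d → ℝ) : Measure (Fin d → ℝ) :=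
  (volume (cube d k z))⁻¹ • volume.restrict (cube d k z)

instance (d : ℕ) (k : ℤ) (z : Fin d → ℝ) : IsProbabilityMeasure (cubeMeasure d k z) := by
  constructor
  have h : (0 : ℝ) < 3 ^ k := by positivity
  rw [cubeMeasure, Measure.smul_apply, Measure.restrict_apply_univ, volume_cube, smul_eq_mul]
  refine ENNReal.inv_mul_cancel (pow_ne_zero _ ?_) (ENNReal.pow_ne_top ENNReal.ofReal_ne_top)
  simpa using h

lemma setAverage_cube (d : ℕ) (k : ℤ) (z : Fin d → ℝ) (f : (Fin d → ℝ) → ℝ) :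
    ⨍ x in cube d k z, f x = ∫ x, f x ∂cubeMeasure d k z :=
  setAverage_eq' _ _ _

lemma integrable_cubeMeasure {d : ℕ} {k : ℤ} {z : Fin d → ℝ} {f : (Fin d → ℝ) → ℝ}
    (hf : ContinuousOn f (closedCube d k z)) : Integrable f (cubeMeasure d k z) := by
  have h : (0 : ℝ) < 3 ^ k := by positivity
  refine Integrable.smul_measure ?_ ?_
  · exact (hf.integrableOn_compact isCompact_Icc).mono_set (cube_subset_closedCube d k z)
  · rw [ENNReal.inv_ne_top, volume_cube]
    refine pow_ne_zero _ ?_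
    simpa using h

lemma ae_cubeMeasure {d : ℕ} {k : ℤ} {z : Fin d → ℝ} {p : (Fin d → ℝ) → Prop}
    (h : ∀ x ∈ cube d k z, p x) : ∀ᵐ x ∂cubeMeasure d k z, p x :=
  Measure.ae_smul_measure (ae_restrict_of_forall_mem (measurableSet_cube d k z) h) _

lemma abs_setAverage_cube_le {d : ℕ} {k : ℤ} {z : Fin d → ℝ} {f : (Fin d → ℝ) → ℝ} {M : ℝ}
    (h : ∀ x ∈ cube d k z, |f x| ≤ M) : |⨍ x in cube d k z, f x| ≤ M := by
  rw [setAverage_cube]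
  simpa using norm_integral_le_of_norm_le_const (μ := cubeMeasure d k z) (f := f)
    (ae_cubeMeasure h)

/-- The integral over a cube is the sum of the integrals over its `3 ^ d` triadic children. -/
lemma setIntegral_cube_eq_sum {d : ℕ} {k : ℤ} {z : Fin d → ℝ} {f : (Fin d → ℝ) → ℝ}
    (hf : IntegrableOn f (closedCube d k z)) :
    ∫ x in cube d k z, f x = ∑ δ ∈ offs d,
      ∫ x in cube d (k - 1) (fun i => z i + 3 ^ (k - 1) * (δ i : ℝ)), f x := by
  have hk : (3 : ℝ) ^ k = 3 * 3 ^ (k - 1) := by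
    rw [← zpow_one_add₀ (by norm_num)]; congr 1; ring
  set c : ℝ := 3 ^ (k - 1) with hc
  have hc0 : 0 < c := by positivity
  set S : (Fin d → ℤ) → Set (Fin d → ℝ) := fun δ => Set.univ.pi fun i =>
    Set.Ioc (z i + c * (δ i : ℝ) - c / 2) (z i + c * (δ i : ℝ) + c / 2) with hS
  have hU : (Set.univ.pi fun i => Set.Ioc (z i - 3 ^ k / 2) (z i + 3 ^ k / 2) :
      Set (Fin d → ℝ)) = ⋃ δ ∈ offs d, S δ := by
    ext x
    simp only [Set.mem_iUnion, hS, Set.mem_univ_pi, Set.mem_Ioc, hk, exists_prop]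
    constructor
    · intro hx
      refine ⟨fun i => if x i ≤ z i - c / 2 then -1 else if x i ≤ z i + c / 2 then 0 else 1,
        ?_, ?_⟩
      · rw [mem_offs]
        intro i
        split_ifs <;> norm_num
      · intro i
        have := hx i
        dsimp only
        split_ifs <;> push_cast <;> constructor <;> linarith
    · rintro ⟨δ, hδ, hx⟩ i
      have h1 := mem_offs.1 hδ i
      have h2 := hx i
      have h3 : (-1 : ℝ) ≤ δ i := by exact_mod_cast h1.1
      have h4 : (δ i : ℝ) ≤ 1 := by exact_mod_cast h1.2
      constructor <;> nlinarith
  have hdisj : (↑(offs d) : Set (Fin d → ℤ)).Pairwise (Function.onFun Disjoint S) := by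
    intro δ _ δ' _ hne
    rw [Function.onFun, Set.disjoint_left]
    intro x hx hx'
    apply hne
    funext i
    have h1 := hx i trivial
    have h2 := hx' i trivial
    simp only [Set.mem_Ioc] at h1 h2
    by_contra hi
    rcases lt_or_gt_of_ne hi with h | h
    · have h3 : (δ i : ℝ) + 1 ≤ δ' i := by exact_mod_cast h
      nlinarith
    · have h3 : (δ' i : ℝ) + 1 ≤ δ i := by exact_mod_cast h
      nlinarith
  rw [setIntegral_congr_set (cube_ae_eq_pi_Ioc d k z), hU, integral_biUnion_finset _ _ hdisj]
  · refine Finset.sum_congr rfl fun δ _ => ?_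
    exact (setIntegral_congr_set (cube_ae_eq_pi_Ioc d (k - 1) _)).symm
  · intro δ hδ
    refine hf.mono_set ?_
    intro x hx'
    have hx : x ∈ ⋃ δ ∈ offs d, S δ := Set.mem_biUnion hδ hx'
    rw [← hU] at hx
    exact ⟨fun i => (hx i trivial).1.le, fun i => (hx i trivial).2⟩
  · intro δ _
    exact MeasurableSet.univ_pi fun _ => measurableSet_Ioc

lemma center_child {d : ℕ} (k : ℤ) (m δ : Fin d → ℤ) :
    center (k - 1) (child m δ) = fun i => center k m i + 3 ^ (k - 1) * (δ i : ℝ) := by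
  have hk : (3 : ℝ) ^ (k - 1) = 3 * 3 ^ (k - 1 - 1) := by
    rw [← zpow_one_add₀ (by norm_num)]; congr 1; ring
  funext i
  simp only [center, child, hk]
  push_cast
  ring

lemma setAverage_cube_eq_childAvg {d : ℕ} {k : ℤ} {m : Fin d → ℤ} {f : (Fin d → ℝ) → ℝ}
    (hf : ContinuousOn f (closedCube d k (center k m))) :
    ⨍ x in cube d k (center k m), f x =
      childAvg (fun m' => ⨍ x in cube d (k - 1) (center (k - 1) m'), f x) m := by
  have hk : (3 : ℝ) ^ k = 3 * 3 ^ (k - 1) := by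
    rw [← zpow_one_add₀ (by norm_num)]; congr 1; ring
  have h0 : (0 : ℝ) < 3 ^ (k - 1) := by positivity
  simp only [childAvg, setAverage_eq, volume_real_cube, smul_eq_mul]
  rw [setIntegral_cube_eq_sum (hf.integrableOn_compact isCompact_Icc), ← Finset.mul_sum,
    ← mul_assoc, hk, mul_pow, mul_inv]
  simp only [center_child]

lemma closedCube_child_subset {d : ℕ} (k : ℤ) (m : Fin d → ℤ) {δ : Fin d → ℤ}
    (hδ : δ ∈ offs d) :
    closedCube d (k - 1) (center (k - 1) (child m δ)) ⊆ closedCube d k (center k m) := by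
  have hk : (3 : ℝ) ^ k = 3 * 3 ^ (k - 1) := by
    rw [← zpow_one_add₀ (by norm_num)]; congr 1; ring
  have h0 : (0 : ℝ) < 3 ^ (k - 1) := by positivity
  rw [center_child]
  rintro x ⟨h1, h2⟩
  refine ⟨fun i => ?_, fun i => ?_⟩ <;>
  · have e1 := h1 i
    have e2 := h2 i
    have h3 : (-1 : ℝ) ≤ δ i := by exact_mod_cast (mem_offs.1 hδ i).1
    have h4 : (δ i : ℝ) ≤ 1 := by exact_mod_cast (mem_offs.1 hδ i).2
    simp only [hk] at e1 e2 ⊢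
    nlinarith

/-- Decomposition of a mean square deviation into variance and squared bias. -/
lemma integral_sub_sq_eq {α : Type*} [MeasurableSpace α] {P : Measure α} [IsProbabilityMeasure P]
    {f : α → ℝ} (hf : Integrable f P) (hf2 : Integrable (fun x => f x ^ 2) P) (c : ℝ) :
    ∫ x, (f x - c) ^ 2 ∂P = ∫ x, (f x - ∫ y, f y ∂P) ^ 2 ∂P + ((∫ y, f y ∂P) - c) ^ 2 := by
  have key : ∀ c : ℝ, ∫ x, (f x - c) ^ 2 ∂P = ∫ x, f x ^ 2 ∂P - 2 * c * ∫ x, f x ∂P + c ^ 2 := by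
    intro c
    have e : ∀ x, (f x - c) ^ 2 = f x ^ 2 - 2 * c * f x + c ^ 2 := fun x => by ring
    simp only [e]
    have h1 : Integrable (fun x => 2 * c * f x) P := hf.const_mul _
    have h2 : Integrable (fun x => f x ^ 2 - 2 * c * f x) P := hf2.sub h1
    rw [integral_add h2 (integrable_const _), integral_sub hf2 h1, integral_const_mul]
    simp
  rw [key, key]
  ring

/-- The divergence theorem for the field `(x i - c) * u` in the direction `i`. -/
lemma integral_Icc_add_mul_fderiv {d : ℕ} {u : (Fin (d + 1) → ℝ) → ℝ} {V : Set (Fin (d + 1) → ℝ)}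
    (hV : IsOpen V) (hu : ContDiffOn ℝ 1 u V) {a b : Fin (d + 1) → ℝ} (hab : a ≤ b)
    (hsub : Set.Icc a b ⊆ V) (i : Fin (d + 1)) (c : ℝ) :
    ∫ x in Set.Icc a b, (u x + (x i - c) * fderiv ℝ u x (Pi.single i 1)) =
      (b i - c) * (∫ y in Set.Icc (a ∘ i.succAbove) (b ∘ i.succAbove), u (i.insertNth (b i) y)) -
      (a i - c) * (∫ y in Set.Icc (a ∘ i.succAbove) (b ∘ i.succAbove), u (i.insertNth (a i) y)) := by
  classical
  set f : Fin (d + 1) → (Fin (d + 1) → ℝ) → ℝ :=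
    fun j x => if j = i then (x i - c) * u x else 0 with hf
  set f' : Fin (d + 1) → (Fin (d + 1) → ℝ) → (Fin (d + 1) → ℝ) →L[ℝ] ℝ := fun j x =>
    if j = i then (x i - c) • fderiv ℝ u x +
      u x • ContinuousLinearMap.proj (R := ℝ) (φ := fun _ : Fin (d + 1) => ℝ) i else 0 with hf'
  have hcu : ContinuousOn u (Set.Icc a b) := hu.continuousOn.mono hsub
  have hcd : ContinuousOn (fun x => fderiv ℝ u x (Pi.single i 1)) (Set.Icc a b) :=
    ((hu.continuousOn_fderiv_of_isOpen hV le_rfl).mono hsub).clm_apply continuousOn_const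
  have hsum : ∀ x, ∑ j, f' j x (Pi.single j 1) =
      u x + (x i - c) * fderiv ℝ u x (Pi.single i 1) := by
    intro x
    rw [Finset.sum_eq_single i]
    · simp [hf', add_comm]
    · intro j _ hj
      simp [hf', hj]
    · simp
  have hx : Continuous fun x : Fin (d + 1) → ℝ => x i - c := by fun_prop
  have h := integral_divergence_of_hasFDerivAt_off_countable' a b hab f f' ∅ Set.countable_empty
    ?_ ?_ ?_
  · simp only [hsum] at h
    rw [h, Finset.sum_eq_single i]
    · simp only [hf, if_true, Fin.insertNth_apply_same, integral_const_mul]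
    · intro j _ hj
      simp [hf, hj]
    · simp
  · intro j
    by_cases hj : j = i
    · simp only [hf, hj, if_true]
      exact hx.continuousOn.mul hcu
    · simp only [hf, hj, if_false]
      exact continuousOn_const
  · rintro x ⟨hx, -⟩ j
    by_cases hj : j = i
    · simp only [hf, hf', hj, if_true]
      have hxV : x ∈ V := hsub ⟨fun i => (hx i trivial).1.le, fun i => (hx i trivial).2.le⟩
      have h1 : HasFDerivAt u (fderiv ℝ u x) x :=
        ((hu.differentiableOn one_ne_zero).differentiableAt (hV.mem_nhds hxV)).hasFDerivAt
      have h2 : HasFDerivAt (fun x : Fin (d + 1) → ℝ => x i - c)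
          (ContinuousLinearMap.proj (R := ℝ) (φ := fun _ : Fin (d + 1) => ℝ) i) x :=
        (hasFDerivAt_apply i x).sub_const c
      exact h2.mul h1
    · simp only [hf, hf', hj, if_false]
      exact hasFDerivAt_const _ _
  · simp only [hsum]
    exact (hcu.add (hx.continuousOn.mul hcd)).integrableOn_compact isCompact_Icc

/-- The average of the `i`-th partial derivative of `u` over a cube. -/
def partialAvg {d : ℕ} (u : (Fin d → ℝ) → ℝ) (i : Fin d) (k : ℤ) (z : Fin d → ℝ) : ℝ :=
  ⨍ x in cube d k z, fderiv ℝ u x (Pi.single i 1)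

/-- The normalized first moment, in the direction `i`, of the `i`-th partial derivative of `u`
over a cube. -/
def partialMoment {d : ℕ} (u : (Fin d → ℝ) → ℝ) (i : Fin d) (k : ℤ) (z : Fin d → ℝ) : ℝ :=
  ⨍ x in cube d k z, (x i - z i) / 3 ^ k * fderiv ℝ u x (Pi.single i 1)

/-- The variance of `u` over a cube. -/
def cubeVar {d : ℕ} (u : (Fin d → ℝ) → ℝ) (k : ℤ) (z : Fin d → ℝ) : ℝ :=
  ⨍ x in cube d k z, (u x - ⨍ y in cube d k z, u y) ^ 2

lemma continuousOn_partial {d : ℕ} {u : (Fin d → ℝ) → ℝ} {V K : Set (Fin d → ℝ)}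
    (hV : IsOpen V) (hu : ContDiffOn ℝ 1 u V) (hK : K ⊆ V) (i : Fin d) :
    ContinuousOn (fun x => fderiv ℝ u x (Pi.single i 1)) K :=
  ((hu.continuousOn_fderiv_of_isOpen hV le_rfl).mono hK).clm_apply continuousOn_const

/-- The averages over two adjacent cubes differ by averages and first moments of the partial
derivative. -/
lemma setAverage_adjacent {d : ℕ} {u : (Fin d → ℝ) → ℝ} {V : Set (Fin d → ℝ)}
    (hV : IsOpen V) (hu : ContDiffOn ℝ 1 u V) {k : ℤ} {z : Fin d → ℝ} {i : Fin d}
    (hz : closedCube d k z ⊆ V)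
    (hz' : closedCube d k (Function.update z i (z i + 3 ^ k)) ⊆ V) :
    (⨍ x in cube d k z, u x) + 3 ^ k * (partialMoment u i k z + partialAvg u i k z / 2) =
      (⨍ x in cube d k (Function.update z i (z i + 3 ^ k)), u x) +
        3 ^ k * (partialMoment u i k (Function.update z i (z i + 3 ^ k)) -
          partialAvg u i k (Function.update z i (z i + 3 ^ k)) / 2) := by
  obtain ⟨d, rfl⟩ : ∃ e, d = e + 1 := ⟨d - 1, by have := i.pos; omega⟩
  have h0 : (0 : ℝ) < 3 ^ k := by positivity
  set h : ℝ := 3 ^ k with hh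
  set z' := Function.update z i (z i + h) with hz'def
  have hzi : z' i = z i + h := by simp [hz'def]
  have hzj : ∀ j, z' (i.succAbove j) = z (i.succAbove j) := fun j => by
    simp [hz'def, Fin.succAbove_ne]
  have key : ∀ (w : Fin (d + 1) → ℝ) (t : ℝ), closedCube (d + 1) k w ⊆ V →
      (⨍ x in cube (d + 1) k w, u x) + h * (partialMoment u i k w + t * partialAvg u i k w) =
      (h ^ (d + 1))⁻¹ * ∫ x in closedCube (d + 1) k w,
        (u x + (x i - (w i - h * t)) * fderiv ℝ u x (Pi.single i 1)) := by
    intro w t hw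
    have c1 : ContinuousOn u (closedCube (d + 1) k w) := hu.continuousOn.mono hw
    have c2 := continuousOn_partial hV hu hw i
    have c3 : ContinuousOn (fun x => (x i - w i) / h * fderiv ℝ u x (Pi.single i 1))
        (closedCube (d + 1) k w) := by
      refine ContinuousOn.mul ?_ c2
      exact Continuous.continuousOn (by fun_prop)
    have i1 := integrable_cubeMeasure c1
    have i2 := integrable_cubeMeasure c2
    have i3 := integrable_cubeMeasure c3
    rw [← setIntegral_congr_set (cube_ae_eq_closedCube (d + 1) k w), hh,
      ← volume_real_cube (d + 1) k w, ← smul_eq_mul (volume.real _)⁻¹, ← setAverage_eq,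
      partialMoment, partialAvg, setAverage_cube, setAverage_cube, setAverage_cube,
      setAverage_cube, ← hh]
    have i4 : Integrable (fun x => h * ((x i - w i) / h * fderiv ℝ u x (Pi.single i 1) +
        t * fderiv ℝ u x (Pi.single i 1))) (cubeMeasure (d + 1) k w) :=
      (i3.add (i2.const_mul t)).const_mul h
    rw [← integral_const_mul, ← integral_add i3 (i2.const_mul t), ← integral_const_mul,
      ← integral_add i1 i4]
    refine integral_congr_ae (Filter.Eventually.of_forall fun x => ?_)
    dsimp only
    field_simp
    ring
  have k1 := key z (1 / 2) hz
  have k2 := key z' (-(1 / 2)) hz'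
  have hle : ∀ w : Fin (d + 1) → ℝ, (fun j => w j - h / 2) ≤ fun j => w j + h / 2 :=
    fun w j => by dsimp only; linarith
  have f1 := integral_Icc_add_mul_fderiv hV hu (hle z) hz i (z i - h * (1 / 2))
  have f2 := integral_Icc_add_mul_fderiv hV hu (hle z') hz' i (z' i - h * -(1 / 2))
  have e1 : (fun j => z' j - h / 2) ∘ i.succAbove = (fun j => z j - h / 2) ∘ i.succAbove := by
    funext j; simp [hzj]
  have e2 : (fun j => z' j + h / 2) ∘ i.succAbove = (fun j => z j + h / 2) ∘ i.succAbove := by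
    funext j; simp [hzj]
  have e3 : z' i - h / 2 = z i + h / 2 := by rw [hzi]; ring
  rw [e1, e2] at f2
  simp only [e3] at f2
  have f3 : (∫ x in closedCube (d + 1) k z,
        (u x + (x i - (z i - h * (1 / 2))) * fderiv ℝ u x (Pi.single i 1))) =
      ∫ x in closedCube (d + 1) k z',
        (u x + (x i - (z' i - h * -(1 / 2))) * fderiv ℝ u x (Pi.single i 1)) := by
    rw [closedCube, closedCube, f1, f2, hzi]
    ring
  rw [f3, ← k2] at k1
  linarith

lemma abs_sub_le_of_adjacent {d : ℕ} {a : (Fin d → ℤ) → ℝ} {T : ℝ} (hT : 0 ≤ T)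
    (h : ∀ δ ∈ offs d, ∀ i, Function.update δ i (δ i + 1) ∈ offs d →
      |a (Function.update δ i (δ i + 1)) - a δ| ≤ T)
    {δ δ' : Fin d → ℤ} (hδ : δ ∈ offs d) (hδ' : δ' ∈ offs d) : |a δ' - a δ| ≤ 2 * d * T := by
  classical
  have hupd : ∀ δ ∈ offs d, ∀ i, ∀ t : ℤ, -1 ≤ t → t ≤ 1 →
      Function.update δ i t ∈ offs d := by
    intro δ hδ i t ht ht'
    rw [mem_offs] at hδ ⊢
    intro j
    by_cases hj : j = i
    · subst hj; simp [ht, ht']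
    · simpa [hj] using hδ j
  have hstep : ∀ δ ∈ offs d, ∀ i, ∀ t : ℤ, -1 ≤ t → t ≤ 0 →
      |a (Function.update δ i (t + 1)) - a (Function.update δ i t)| ≤ T := by
    intro δ hδ i t ht ht'
    have := h (Function.update δ i t) (hupd δ hδ i t ht (by omega)) i
    simp only [Function.update_self, Function.update_idem] at this
    exact this (hupd δ hδ i _ (by omega) (by omega))
  have hone : ∀ δ ∈ offs d, ∀ i, ∀ t : ℤ, -1 ≤ t → t ≤ 1 →
      |a (Function.update δ i t) - a δ| ≤ 2 * T := by
    intro δ hδ i t ht ht'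
    have s1 := abs_le.1 (hstep δ hδ i (-1) (by norm_num) (by norm_num))
    have s2 := abs_le.1 (hstep δ hδ i 0 (by norm_num) (by norm_num))
    norm_num at s1 s2
    have hδi := mem_offs.1 hδ i
    have heq : a δ = a (Function.update δ i (δ i)) := by rw [Function.update_eq_self]
    rw [heq]
    have ht3 : t = -1 ∨ t = 0 ∨ t = 1 := by omega
    have hd3 : δ i = -1 ∨ δ i = 0 ∨ δ i = 1 := by omega
    rw [abs_le]
    rcases ht3 with rfl | rfl | rfl <;> rcases hd3 with h' | h' | h' <;> rw [h'] <;>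
      constructor <;> linarith
  have hind : ∀ S : Finset (Fin d), S.piecewise δ' δ ∈ offs d ∧
      |a (S.piecewise δ' δ) - a δ| ≤ 2 * S.card * T := by
    intro S
    induction S using Finset.induction_on with
    | empty => simpa using hδ
    | insert j S hj ih =>
      have hj' := mem_offs.1 hδ' j
      rw [Finset.piecewise_insert, Finset.card_insert_of_notMem hj]
      refine ⟨hupd _ ih.1 _ _ hj'.1 hj'.2, ?_⟩
      have h1 := hone _ ih.1 j _ hj'.1 hj'.2
      have h2 := abs_sub_le (a (Function.update (S.piecewise δ' δ) j (δ' j)))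
        (a (S.piecewise δ' δ)) (a δ)
      push_cast
      linarith [ih.2]
  simpa using (hind Finset.univ).2

lemma cubeVar_le {d : ℕ} {u : (Fin d → ℝ) → ℝ} {V : Set (Fin d → ℝ)}
    (hV : IsOpen V) (hu : ContDiffOn ℝ 1 u V) {k : ℤ} {m : Fin d → ℤ}
    (hK : closedCube d k (center k m) ⊆ V) :
    cubeVar u k (center k m) ≤
      childAvg (fun m' => cubeVar u (k - 1) (center (k - 1) m')) m +
      32 * d ^ 2 * 3 ^ d * ((3 : ℝ) ^ (k - 1)) ^ 2 *
        childAvg (fun m' => ∑ i, partialAvg u i (k - 1) (center (k - 1) m') ^ 2 +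
          ∑ i, partialMoment u i (k - 1) (center (k - 1) m') ^ 2) m := by
  set h : ℝ := 3 ^ (k - 1) with hh
  have h0 : 0 < h := by positivity
  set A : (Fin d → ℤ) → ℝ := fun δ => ⨍ x in cube d (k - 1) (center (k - 1) (child m δ)), u x
    with hA
  set a : ℝ := ⨍ x in cube d k (center k m), u x with ha
  set Q : (Fin d → ℤ) → ℝ := fun m' => ∑ i, partialAvg u i (k - 1) (center (k - 1) m') ^ 2 +
    ∑ i, partialMoment u i (k - 1) (center (k - 1) m') ^ 2 with hQ
  have hQ0 : ∀ m', 0 ≤ Q m' := fun m' => by simp only [hQ]; positivity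
  set S : ℝ := ∑ δ ∈ offs d, Q (child m δ) with hS
  have hS0 : 0 ≤ S := Finset.sum_nonneg fun δ _ => hQ0 _
  have hT0 : 0 ≤ 8 * h ^ 2 * S := mul_nonneg (mul_nonneg (by norm_num) (sq_nonneg h)) hS0
  have hQS : ∀ δ ∈ offs d, Q (child m δ) ≤ S := fun δ hδ =>
    Finset.single_le_sum (f := fun δ => Q (child m δ)) (fun δ _ => hQ0 _) hδ
  have hcu : ContinuousOn u (closedCube d k (center k m)) := hu.continuousOn.mono hK
  have hadj : ∀ δ ∈ offs d, ∀ i, Function.update δ i (δ i + 1) ∈ offs d →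
      |A (Function.update δ i (δ i + 1)) - A δ| ≤ √(8 * h ^ 2 * S) := by
    intro δ hδ i hδ'
    apply Real.abs_le_sqrt
    have hz : Function.update (center (k - 1) (child m δ)) i
        (center (k - 1) (child m δ) i + 3 ^ (k - 1)) =
        center (k - 1) (child m (Function.update δ i (δ i + 1))) := by
      funext j
      by_cases hj : j = i
      · subst hj
        simp only [center_child, Function.update_self]
        push_cast
        ring
      · simp only [center_child, Function.update_of_ne hj]
    have e := setAverage_adjacent hV hu (k := k - 1) (z := center (k - 1) (child m δ)) (i := i)
      ((closedCube_child_subset k m hδ).trans hK)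
      (by rw [hz]; exact (closedCube_child_subset k m hδ').trans hK)
    rw [hz] at e
    have q1 := hQS δ hδ
    have q2 := hQS _ hδ'
    have t : ∀ m', partialAvg u i (k - 1) (center (k - 1) m') ^ 2 +
        partialMoment u i (k - 1) (center (k - 1) m') ^ 2 ≤ Q m' := fun m' =>
      add_le_add
        (Finset.single_le_sum (f := fun i => partialAvg u i (k - 1) (center (k - 1) m') ^ 2)
          (fun _ _ => sq_nonneg _) (Finset.mem_univ i))
        (Finset.single_le_sum (f := fun i => partialMoment u i (k - 1) (center (k - 1) m') ^ 2)
          (fun _ _ => sq_nonneg _) (Finset.mem_univ i))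
    have t1 := (t _).trans q1
    have t2 := (t _).trans q2
    set g := partialAvg u i (k - 1) (center (k - 1) (child m δ))
    set g' := partialAvg u i (k - 1) (center (k - 1) (child m (Function.update δ i (δ i + 1))))
    set l := partialMoment u i (k - 1) (center (k - 1) (child m δ))
    set l' := partialMoment u i (k - 1) (center (k - 1) (child m (Function.update δ i (δ i + 1))))
    have e' : A (Function.update δ i (δ i + 1)) - A δ = h * (l - l' + g / 2 + g' / 2) := by
      simp only [hA, hh]
      linarith
    have e2 : (l - l' + g / 2 + g' / 2) ^ 2 ≤ 8 * S := by
      nlinarith [sq_nonneg (l + l'), sq_nonneg (l - g / 2), sq_nonneg (l - g' / 2),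
        sq_nonneg (l' + g / 2), sq_nonneg (l' + g' / 2), sq_nonneg (g - g'),
        sq_nonneg g, sq_nonneg g']
    rw [e', mul_pow]
    nlinarith [sq_nonneg h]
  have hchain : ∀ δ ∈ offs d, ∀ δ' ∈ offs d, |A δ' - A δ| ≤ 2 * d * √(8 * h ^ 2 * S) :=
    fun δ hδ δ' hδ' => abs_sub_le_of_adjacent (Real.sqrt_nonneg _) hadj hδ hδ'
  have haA : a = ((3 : ℝ) ^ d)⁻¹ * ∑ δ ∈ offs d, A δ := setAverage_cube_eq_childAvg hcu
  have hdev : ∀ δ ∈ offs d, (A δ - a) ^ 2 ≤ 32 * d ^ 2 * h ^ 2 * S := by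
    intro δ hδ
    have e1 : A δ - a = ((3 : ℝ) ^ d)⁻¹ * ∑ δ' ∈ offs d, (A δ - A δ') := by
      rw [haA, Finset.sum_sub_distrib, Finset.sum_const, card_offs, nsmul_eq_mul]
      push_cast
      field_simp
    have e2 : |A δ - a| ≤ 2 * d * √(8 * h ^ 2 * S) := by
      rw [e1, abs_mul, abs_of_pos (by positivity), inv_mul_le_iff₀ (by positivity)]
      refine (Finset.abs_sum_le_sum_abs _ _).trans ?_
      refine (Finset.sum_le_sum fun δ' hδ' => hchain δ' hδ' δ hδ).trans (le_of_eq ?_)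
      rw [Finset.sum_const, card_offs, nsmul_eq_mul]
      push_cast
      rfl
    calc (A δ - a) ^ 2 = |A δ - a| ^ 2 := (sq_abs _).symm
      _ ≤ (2 * d * √(8 * h ^ 2 * S)) ^ 2 := pow_le_pow_left₀ (abs_nonneg _) e2 2
      _ = 32 * d ^ 2 * h ^ 2 * S := by
        rw [mul_pow, Real.sq_sqrt hT0]; ring
  have hsplit : cubeVar u k (center k m) = ((3 : ℝ) ^ d)⁻¹ * ∑ δ ∈ offs d,
      (cubeVar u (k - 1) (center (k - 1) (child m δ)) + (A δ - a) ^ 2) := by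
    rw [cubeVar, ← ha, setAverage_cube_eq_childAvg (f := fun x => (u x - a) ^ 2)
      ((hcu.sub continuousOn_const).pow 2), childAvg]
    congr 1
    refine Finset.sum_congr rfl fun δ hδ => ?_
    have c := hcu.mono (closedCube_child_subset k m hδ)
    simp only [cubeVar, hA, setAverage_cube]
    exact integral_sub_sq_eq (integrable_cubeMeasure c) (integrable_cubeMeasure (c.pow 2)) a
  have hSQ : childAvg Q m = ((3 : ℝ) ^ d)⁻¹ * S := rfl
  rw [hsplit, Finset.sum_add_distrib, mul_add, hSQ]
  refine add_le_add le_rfl ?_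
  rw [inv_mul_le_iff₀ (by positivity)]
  refine (Finset.sum_le_sum hdev).trans (le_of_eq ?_)
  rw [Finset.sum_const, card_offs, nsmul_eq_mul]
  push_cast
  field_simp

lemma partialMoment_eq {d : ℕ} {u : (Fin d → ℝ) → ℝ} {V : Set (Fin d → ℝ)}
    (hV : IsOpen V) (hu : ContDiffOn ℝ 1 u V) {k : ℤ} {m : Fin d → ℤ}
    (hK : closedCube d k (center k m) ⊆ V) (i : Fin d) :
    partialMoment u i k (center k m) = ((3 : ℝ) ^ d)⁻¹ * ∑ δ ∈ offs d,
      1 / 3 * (partialMoment u i (k - 1) (center (k - 1) (child m δ)) +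
        δ i * partialAvg u i (k - 1) (center (k - 1) (child m δ))) := by
  have hk : (3 : ℝ) ^ k = 3 * 3 ^ (k - 1) := by
    rw [← zpow_one_add₀ (by norm_num)]; congr 1; ring
  have h0 : (0 : ℝ) < 3 ^ (k - 1) := by positivity
  have hc := continuousOn_partial hV hu hK i
  rw [partialMoment, setAverage_cube_eq_childAvg, childAvg]
  · congr 1
    refine Finset.sum_congr rfl fun δ hδ => ?_
    have c := hc.mono (closedCube_child_subset k m hδ)
    have c' : ContinuousOn (fun x => (x i - center (k - 1) (child m δ) i) / 3 ^ (k - 1) *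
        fderiv ℝ u x (Pi.single i 1)) (closedCube d (k - 1) (center (k - 1) (child m δ))) := by
      refine ContinuousOn.mul ?_ c
      exact Continuous.continuousOn (by fun_prop)
    rw [partialMoment, partialAvg, setAverage_cube, setAverage_cube, setAverage_cube,
      ← integral_const_mul, ← integral_add (integrable_cubeMeasure c')
        ((integrable_cubeMeasure c).const_mul _), ← integral_const_mul]
    refine integral_congr_ae (Filter.Eventually.of_forall fun x => ?_)
    simp only [center_child, hk]
    field_simp
    ring
  · refine ContinuousOn.mul ?_ hc
    exact Continuous.continuousOn (by fun_prop)

lemma sum_partialMoment_sq_le {d : ℕ} {u : (Fin d → ℝ) → ℝ} {V : Set (Fin d → ℝ)}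
    (hV : IsOpen V) (hu : ContDiffOn ℝ 1 u V) {k : ℤ} {m : Fin d → ℤ}
    (hK : closedCube d k (center k m) ⊆ V) {η : ℝ} (hη : 0 < η) :
    ∑ i, partialMoment u i k (center k m) ^ 2 ≤
      (1 + η) / 9 *
        childAvg (fun m' => ∑ i, partialMoment u i (k - 1) (center (k - 1) m') ^ 2) m +
      (1 + η⁻¹) / 9 *
        childAvg (fun m' => ∑ i, partialAvg u i (k - 1) (center (k - 1) m') ^ 2) m := by
  have young : ∀ x y : ℝ, (x + y) ^ 2 ≤ (1 + η) * x ^ 2 + (1 + η⁻¹) * y ^ 2 := by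
    intro x y
    have e : (1 + η) * x ^ 2 + (1 + η⁻¹) * y ^ 2 - (x + y) ^ 2 = η⁻¹ * (η * x - y) ^ 2 := by
      field_simp
      ring
    have : 0 ≤ η⁻¹ * (η * x - y) ^ 2 := by positivity
    linarith
  have hi : ∀ i, partialMoment u i k (center k m) ^ 2 ≤ ((3 : ℝ) ^ d)⁻¹ * ∑ δ ∈ offs d,
      ((1 + η) / 9 * partialMoment u i (k - 1) (center (k - 1) (child m δ)) ^ 2 +
       (1 + η⁻¹) / 9 * partialAvg u i (k - 1) (center (k - 1) (child m δ)) ^ 2) := by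
    intro i
    rw [partialMoment_eq hV hu hK i, mul_pow]
    have hcs := sq_sum_le_card_mul_sum_sq (s := offs d) (f := fun δ =>
      1 / 3 * (partialMoment u i (k - 1) (center (k - 1) (child m δ)) +
        δ i * partialAvg u i (k - 1) (center (k - 1) (child m δ))))
    rw [card_offs] at hcs
    push_cast at hcs
    calc _ ≤ (((3 : ℝ) ^ d)⁻¹) ^ 2 * (3 ^ d * ∑ δ ∈ offs d,
          (1 / 3 * (partialMoment u i (k - 1) (center (k - 1) (child m δ)) +
          δ i * partialAvg u i (k - 1) (center (k - 1) (child m δ)))) ^ 2) := by gcongr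
      _ = ((3 : ℝ) ^ d)⁻¹ * ∑ δ ∈ offs d,
          (1 / 3 * (partialMoment u i (k - 1) (center (k - 1) (child m δ)) +
          δ i * partialAvg u i (k - 1) (center (k - 1) (child m δ)))) ^ 2 := by
          field_simp
      _ ≤ _ := by
          gcongr with δ hδ
          have h3 : (-1 : ℝ) ≤ δ i := by exact_mod_cast (mem_offs.1 hδ i).1
          have h4 : (δ i : ℝ) ≤ 1 := by exact_mod_cast (mem_offs.1 hδ i).2
          have h5 : (δ i : ℝ) ^ 2 ≤ 1 := by nlinarith
          have h6 := young (partialMoment u i (k - 1) (center (k - 1) (child m δ)))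
            (δ i * partialAvg u i (k - 1) (center (k - 1) (child m δ)))
          have h7 : (1 + η⁻¹) * ((δ i : ℝ) *
              partialAvg u i (k - 1) (center (k - 1) (child m δ))) ^ 2 ≤
              (1 + η⁻¹) * partialAvg u i (k - 1) (center (k - 1) (child m δ)) ^ 2 := by
            rw [mul_pow]
            gcongr
            exact mul_le_of_le_one_left (sq_nonneg _) h5
          linarith
  refine (Finset.sum_le_sum fun i _ => hi i).trans (le_of_eq ?_)
  simp only [childAvg]
  rw [← Finset.mul_sum, Finset.sum_comm]
  simp only [Finset.sum_add_distrib, ← Finset.mul_sum]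
  ring

/-! ### The lattice of subcubes -/

lemma center_injective {d : ℕ} (k : ℤ) : Function.Injective (center (d := d) k) := by
  intro m m' h
  funext i
  have h1 := congrFun h i
  have h0 : (3 : ℝ) ^ (k - 1) ≠ 0 := by positivity
  simpa [center, h0] using h1

lemma closedCube_subset_iff {d : ℕ} (n : ℤ) (J : ℕ) (m : Fin d → ℤ) :
    closedCube d (n - J) (center (n - J) m) ⊆ closedCube d n 0 ↔ m ∈ subIdx d J := by
  have hc : (0 : ℝ) < 3 ^ (n - J - 1) := by positivity
  have hk : (3 : ℝ) ^ (n - J) = 3 * 3 ^ (n - J - 1) := by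
    rw [← zpow_one_add₀ (by norm_num)]; congr 1; ring
  have hn : (3 : ℝ) ^ n = 3 ^ (J + 1) * 3 ^ (n - J - 1) := by
    rw [← zpow_natCast, ← zpow_add₀ (by norm_num)]; congr 1; push_cast; ring
  set c : ℝ := 3 ^ (n - J - 1) with hcd
  have hm : m ∈ subIdx d J ↔ ∀ i, 2 * |(m i : ℝ)| + 3 ≤ 3 ^ (J + 1) := by
    rw [mem_subIdx]
    exact forall_congr' fun i => by exact_mod_cast Iff.rfl
  rw [hm, closedCube, closedCube, Set.Icc_subset_Icc_iff
    (fun i => by dsimp only; rw [hk]; linarith)]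
  simp only [Pi.le_def, ← forall_and, center, ← hcd, hk, hn, Pi.zero_apply]
  refine forall_congr' fun i => ?_
  constructor
  · rintro ⟨h1, h2⟩
    have e1 : c * (-(2 * (m i : ℝ)) + 3) ≤ c * 3 ^ (J + 1) := by linarith
    have e2 : c * (2 * (m i : ℝ) + 3) ≤ c * 3 ^ (J + 1) := by linarith
    have e1' := le_of_mul_le_mul_left e1 hc
    have e2' := le_of_mul_le_mul_left e2 hc
    cases abs_cases (m i : ℝ) <;> linarith
  · intro h
    have e1 := mul_le_mul_of_nonneg_left (neg_le_abs (m i : ℝ)) hc.le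
    have e2 := mul_le_mul_of_nonneg_left (le_abs_self (m i : ℝ)) hc.le
    have e3 := mul_le_mul_of_nonneg_left h hc.le
    constructor <;> linarith

lemma cube_subset_iff {d : ℕ} {k n : ℤ} {z w : Fin d → ℝ} :
    cube d k z ⊆ cube d n w ↔ closedCube d k z ⊆ closedCube d n w := by
  constructor
  · intro h
    rw [closedCube_eq_closure, closedCube_eq_closure]
    exact closure_mono h
  · intro h
    have e : ∀ k z, interior (closedCube d k z) = cube d k z := by
      intro k z
      rw [closedCube, ← Set.pi_univ_Icc, interior_pi_set Set.finite_univ, cube_eq_pi]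
      simp only [interior_Icc]
    rw [← e, ← e]
    exact interior_mono h

lemma subLatt_eq_image (d : ℕ) (n : ℤ) (J : ℕ) :
    subLatt d (n - J) n = center (n - J) '' (subIdx d J : Set (Fin d → ℤ)) := by
  ext z
  simp only [subLatt, latt, Set.mem_ofPred_eq, Set.mem_image, Finset.mem_coe, Qc_eq_cube,
    cube_subset_iff]
  constructor
  · rintro ⟨⟨m, rfl⟩, h⟩
    exact ⟨m, (closedCube_subset_iff n J m).1 h, rfl⟩
  · rintro ⟨m, hm, rfl⟩
    exact ⟨⟨m, rfl⟩, (closedCube_subset_iff n J m).2 hm⟩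

lemma avgSet_subLatt (d : ℕ) (n : ℤ) (J : ℕ) (f : (Fin d → ℝ) → ℝ) :
    avgSet (subLatt d (n - J) n) f = idxAvg J fun m => f (center (n - J) m) := by
  rw [avgSet, subLatt_eq_image, Set.ncard_image_of_injective _ (center_injective _),
    Set.ncard_coe_finset, finsum_mem_image (center_injective _).injOn, finsum_mem_coe_finset,
    idxAvg]

/-! ### A priori bounds -/

section Bounds

variable {d : ℕ} {u : (Fin d → ℝ) → ℝ} {k : ℤ} {z : Fin d → ℝ} {B : ℝ}

lemma abs_fderiv_single_le {x : Fin d → ℝ} (h : ‖fderiv ℝ u x‖ ≤ B) (i : Fin d) :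
    |fderiv ℝ u x (Pi.single i 1)| ≤ B := by
  have := (fderiv ℝ u x).le_opNorm (Pi.single i 1)
  rw [Pi.norm_single, norm_one, mul_one] at this
  exact this.trans h

lemma partialAvg_sq_le (hB : ∀ x ∈ closedCube d k z, ‖fderiv ℝ u x‖ ≤ B) (i : Fin d) :
    partialAvg u i k z ^ 2 ≤ B ^ 2 :=
  sq_le_sq' (neg_le_of_abs_le (abs_setAverage_cube_le fun x hx =>
    abs_fderiv_single_le (hB x (cube_subset_closedCube d k z hx)) i))
    (le_of_abs_le (abs_setAverage_cube_le fun x hx =>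
    abs_fderiv_single_le (hB x (cube_subset_closedCube d k z hx)) i))

lemma partialMoment_sq_le (hB : ∀ x ∈ closedCube d k z, ‖fderiv ℝ u x‖ ≤ B) (i : Fin d) :
    partialMoment u i k z ^ 2 ≤ B ^ 2 := by
  have h0 : (0 : ℝ) < 3 ^ k := by positivity
  have h : |partialMoment u i k z| ≤ B := by
    refine abs_setAverage_cube_le fun x hx => ?_
    have h1 := abs_fderiv_single_le (hB x (cube_subset_closedCube d k z hx)) i
    have h2 : |(x i - z i) / 3 ^ k| ≤ 1 := by
      rw [abs_div, abs_of_pos h0, div_le_one h0]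
      linarith [hx i]
    rw [abs_mul]
    exact (mul_le_of_le_one_left (abs_nonneg _) h2).trans h1
  exact sq_le_sq' (neg_le_of_abs_le h) (le_of_abs_le h)

lemma cubeVar_nonneg : 0 ≤ cubeVar u k z := by
  rw [cubeVar, setAverage_cube]
  exact integral_nonneg fun _ => sq_nonneg _

lemma cubeVar_le_of_norm_fderiv_le (hd : ∀ x ∈ closedCube d k z, DifferentiableAt ℝ u x)
    (hB : ∀ x ∈ closedCube d k z, ‖fderiv ℝ u x‖ ≤ B) :
    cubeVar u k z ≤ B ^ 2 * ((3 : ℝ) ^ k) ^ 2 := by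
  have h0 : (0 : ℝ) < 3 ^ k := by positivity
  have hc : ContinuousOn u (closedCube d k z) := fun x hx =>
    (hd x hx).continuousAt.continuousWithinAt
  have hi := integrable_cubeMeasure hc
  have hzm : z ∈ closedCube d k z := ⟨fun i => by dsimp only; linarith, fun i => by
    dsimp only; linarith⟩
  have hB0 : 0 ≤ B := (norm_nonneg _).trans (hB z hzm)
  have hlip : ∀ x ∈ cube d k z, ∀ y ∈ cube d k z, |u x - u y| ≤ B * 3 ^ k := by
    intro x hx y hy
    have h1 := (convex_Icc _ _).norm_image_sub_le_of_norm_fderiv_le hd hB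
      (cube_subset_closedCube d k z hy) (cube_subset_closedCube d k z hx)
    rw [Real.norm_eq_abs] at h1
    refine h1.trans (mul_le_mul_of_nonneg_left ?_ hB0)
    refine (pi_norm_le_iff_of_nonneg h0.le).2 fun i => ?_
    have h2 := abs_lt.1 (hx i)
    have h3 := abs_lt.1 (hy i)
    rw [Real.norm_eq_abs, Pi.sub_apply, abs_le]
    constructor <;> linarith
  rw [cubeVar, ← mul_pow]
  refine (le_abs_self _).trans (abs_setAverage_cube_le fun x hx => ?_)
  have e : u x - ⨍ y in cube d k z, u y = ⨍ y in cube d k z, (u x - u y) := by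
    rw [setAverage_cube, setAverage_cube, integral_sub (integrable_const _) hi]
    simp
  have h : |u x - ⨍ y in cube d k z, u y| ≤ B * 3 ^ k := by
    rw [e]
    exact abs_setAverage_cube_le fun y hy => hlip x hx y hy
  rw [abs_pow]
  exact pow_le_pow_left₀ (abs_nonneg _) h 2

end Bounds

/-- Subtracting a constant does not change the mean square deviation from the average. -/
lemma setAverage_sub_const_eq_cubeVar {d : ℕ} {u : (Fin d → ℝ) → ℝ} {k : ℤ} {z : Fin d → ℝ}
    (hu : ContinuousOn u (closedCube d k z)) (c : ℝ) :
    ⨍ x in cube d k z, ((u x - c) - ⨍ y in cube d k z, (u y - c)) ^ 2 = cubeVar u k z := by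
  have e : ⨍ y in cube d k z, (u y - c) = (⨍ y in cube d k z, u y) - c := by
    rw [setAverage_cube, setAverage_cube,
      integral_sub (integrable_cubeMeasure hu) (integrable_const _)]
    simp
  rw [e, cubeVar]
  congr 1
  funext x
  ring

/-- The multiscale variance is controlled by the multiscale averages of the gradient. -/
lemma sum_idxAvg_cubeVar_le (d : ℕ) {s : ℝ} (hs : 0 < s) (hs1 : s < 1) :
    ∃ C : ℝ, 0 < C ∧ ∀ (n : ℤ) (u : (Fin d → ℝ) → ℝ) (V : Set (Fin d → ℝ)), IsOpen V →
      closedCube d n 0 ⊆ V → ContDiffOn ℝ 1 u V → ∀ N : ℕ,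
      ∑ j ∈ Finset.range N, (3 : ℝ) ^ (-2 * s * ((n : ℝ) - (j : ℝ))) *
        idxAvg j (fun m => cubeVar u (n - j) (center (n - j) m)) ≤
      C * ∑' j : ℕ, (3 : ℝ) ^ (2 * (1 - s) * ((n : ℝ) - (j : ℝ))) *
        idxAvg j (fun m => ∑ i, partialAvg u i (n - j) (center (n - j) m) ^ 2) := by
  obtain ⟨C, hC, h⟩ := sum_idxAvg_le d hs hs1 (C₀ := 32 * d ^ 2 * 3 ^ d) (by positivity)
  refine ⟨C, hC, fun n u V hV hQV hu => ?_⟩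
  obtain ⟨B, hB⟩ := (isCompact_Icc : IsCompact (closedCube d n 0)).exists_bound_of_continuousOn
    ((hu.continuousOn_fderiv_of_isOpen hV le_rfl).mono hQV)
  have hsub : ∀ J, ∀ m ∈ subIdx d J,
      closedCube d (n - J) (center (n - J) m) ⊆ closedCube d n 0 := fun J m hm =>
    (closedCube_subset_iff n J m).2 hm
  have hBJ : ∀ J, ∀ m ∈ subIdx d J, ∀ x ∈ closedCube d (n - J) (center (n - J) m),
      ‖fderiv ℝ u x‖ ≤ B := fun J m hm x hx => hB x (hsub J m hm hx)
  have hd : ∀ x ∈ closedCube d n 0, DifferentiableAt ℝ u x := fun x hx =>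
    (hu.differentiableOn one_ne_zero).differentiableAt (hV.mem_nhds (hQV hx))
  have hk : ∀ J : ℕ, n - ((J + 1 : ℕ) : ℤ) = n - J - 1 := fun J => by push_cast; ring
  have hM : (d : ℝ) * B ^ 2 ≤ (d + 1) * B ^ 2 := by nlinarith [sq_nonneg B]
  refine h n (fun J m => cubeVar u (n - J) (center (n - J) m))
    (fun J m => ∑ i, partialMoment u i (n - J) (center (n - J) m) ^ 2)
    (fun J m => ∑ i, partialAvg u i (n - J) (center (n - J) m) ^ 2) ((d + 1) * B ^ 2)
    (fun J m _ => cubeVar_nonneg) (fun J m _ => Finset.sum_nonneg fun _ _ => sq_nonneg _)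
    (fun J m _ => Finset.sum_nonneg fun _ _ => sq_nonneg _) ?_ ?_ ?_ ?_ ?_
  · intro J m hm
    refine (cubeVar_le_of_norm_fderiv_le (fun x hx => hd x (hsub J m hm hx)) (hBJ J m hm)).trans ?_
    refine mul_le_mul_of_nonneg_right ?_ (sq_nonneg _)
    exact le_mul_of_one_le_left (sq_nonneg B) (by linarith [Nat.cast_nonneg (α := ℝ) d])
  · intro J m hm
    refine (Finset.sum_le_sum fun i _ => partialMoment_sq_le (hBJ J m hm) i).trans ?_
    simpa using hM
  · intro J m hm
    refine (Finset.sum_le_sum fun i _ => partialAvg_sq_le (hBJ J m hm) i).trans ?_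
    simpa using hM
  · intro J m hm
    rw [hk]
    exact cubeVar_le hV hu ((hsub J m hm).trans hQV)
  · intro η hη J m hm
    rw [hk]
    exact sum_partialMoment_sq_le hV hu ((hsub J m hm).trans hQV) hη

/-- Fractional Poincaré inequality. -/
theorem stmt3 (d : ℕ) (hd : 1 ≤ d) (s : ℝ) (hs : s ∈ Set.Ioo (0 : ℝ) 1) :
    ∃ C : ℝ, 0 < C ∧ ∀ (n : ℤ) (u : (Fin d → ℝ) → ℝ),
      (∃ V, IsOpen V ∧ closure (Qc d n) ⊆ V ∧ ContDiffOn ℝ 1 u V) →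
      fracNorm d s n (fun x => u x - ⨍ y in Qc d n, u y) ≤
        C * ringNeg d (1 - s) n (grad d u) := by
  obtain ⟨C, hC, h⟩ := sum_idxAvg_cubeVar_le d hs.1 hs.2
  refine ⟨2 * √C, by positivity, ?_⟩
  rintro n u ⟨V, hV, hQV, hu⟩
  rw [Qc_eq_cube, ← closedCube_eq_closure] at hQV
  replace h := h n u V hV hQV hu
  set R : ℝ := ∑' j : ℕ, (3 : ℝ) ^ (2 * (1 - s) * ((n : ℝ) - (j : ℝ))) *
    idxAvg j (fun m => ∑ i, partialAvg u i (n - j) (center (n - j) m) ^ 2) with hR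
  have hneg : ringNeg d (1 - s) n (grad d u) = √R := by
    simp only [ringNeg, avgSet_subLatt, grad, hR, partialAvg]
  have hsemi : ∀ c : ℝ, fracSemi d s n (fun x => u x - c) =
      √(∑' j : ℕ, (3 : ℝ) ^ (-2 * s * ((n : ℝ) - (j : ℝ))) *
        idxAvg j (fun m => cubeVar u (n - j) (center (n - j) m))) := by
    intro c
    simp only [fracSemi, avgSet_subLatt]
    congr 1
    refine tsum_congr fun j => ?_
    rw [idxAvg, idxAvg]
    congr 2
    refine Finset.sum_congr rfl fun m hm => ?_
    exact setAverage_sub_const_eq_cubeVar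
      (hu.continuousOn.mono (((closedCube_subset_iff n j m).2 hm).trans hQV)) c
  have hzero : idxAvg 0 (fun m => cubeVar u (n - (0 : ℕ)) (center (n - (0 : ℕ)) m)) =
      cubeVar u n 0 := by
    have e : subIdx d 0 = {0} := by
      ext m
      rw [mem_subIdx, Finset.mem_singleton, funext_iff]
      refine forall_congr' fun i => ?_
      have := abs_nonneg (m i)
      rw [Pi.zero_apply, ← abs_eq_zero (a := m i)]
      omega
    have hc : center (d := d) n 0 = 0 := by
      funext i
      simp [center]
    simp [idxAvg, e, hc]
  have hfirst : (3 : ℝ) ^ (-(s * (n : ℝ))) *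
      √(⨍ x in Qc d n, (u x - ⨍ y in Qc d n, u y) ^ 2) ≤ √C * √R := by
    have h1 := h 1
    rw [Finset.sum_range_one, hzero, Nat.cast_zero, sub_zero] at h1
    have e : (3 : ℝ) ^ (-2 * s * (n : ℝ)) = ((3 : ℝ) ^ (-(s * (n : ℝ)))) ^ 2 := by
      rw [← Real.rpow_natCast, ← Real.rpow_mul (by norm_num)]
      congr 1
      push_cast
      ring
    rw [e] at h1
    rw [Qc_eq_cube, ← Real.sqrt_mul hC.le]
    apply Real.le_sqrt_of_sq_le
    rw [← cubeVar]
    rwa [mul_pow, Real.sq_sqrt cubeVar_nonneg]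
  have hsecond : ∀ c : ℝ, fracSemi d s n (fun x => u x - c) ≤ √C * √R := by
    intro c
    rw [hsemi, ← Real.sqrt_mul hC.le]
    refine Real.sqrt_le_sqrt (Real.tsum_le_of_sum_range_le (fun j => ?_) h)
    exact mul_nonneg (by positivity) (idxAvg_nonneg fun _ _ => cubeVar_nonneg)
  rw [fracNorm, hneg]
  linarith [hsecond (⨍ y in Qc d n, u y)]

end
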